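/- Suppose a² + b² ≠ 0. Then there is no smooth (1,2)-tensor field T on ℝ⁴ (with components T^k_{ij}) satisfying the Ambrose–Singer equations for the metric g and its Levi-Civita connection ∇, namely for all indices: (i) g(T_{∂_i}∂_j, ∂_k) + g(∂_j, T_{∂_i}∂_k) = 0; (ii) (∇_{∂_i}R)(∂_j,∂_k) = [T_{∂_i}, R(∂_j,∂_k)] − R(T_{∂_i}∂_j, ∂_k) − R(∂_j, T_{∂_i}∂_k); (iii) (∇_{∂_i}T)_{∂_j} = [T_{∂_i}, T_{∂_j}] − T_{T_{∂_i}∂_j}. Consequently no four-dimensional two-symmetric Lorentzian manifold carries a homogeneous pseudo-Riemannian structure, i.e. none is reductive homogeneous. -/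

import Mathlib

noncomputable section

open scoped BigOperators

/-- The metric of a four-dimensional two-symmetric Lorentzian manifold, in
coordinates `x 0 = x¹, x 1 = x², x 2 = x³, x 3 = x⁴`:
`g₁₄ = g₄₁ = g₂₂ = g₃₃ = 1`,
`g₄₄ = x⁴(a(x²)² + b(x³)²) + p(x²)² + 2q x²x³ + s(x³)²`, all others zero. -/
def gmat (a b p q s : ℝ) (x : Fin 4 → ℝ) : Matrix (Fin 4) (Fin 4) ℝ :=
  Matrix.of fun i j =>
    if i = 0 ∧ j = 3 then 1
    else if i = 3 ∧ j = 0 then 1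
    else if i = 1 ∧ j = 1 then 1
    else if i = 2 ∧ j = 2 then 1
    else if i = 3 ∧ j = 3 then
      x 3 * (a * (x 1) ^ 2 + b * (x 2) ^ 2) + p * (x 1) ^ 2
        + 2 * q * x 1 * x 2 + s * (x 2) ^ 2
    else 0

/-- The inverse matrix `g^{ij}`. -/
def ginv (a b p q s : ℝ) (x : Fin 4 → ℝ) : Matrix (Fin 4) (Fin 4) ℝ :=
  (gmat a b p q s x)⁻¹

/-- Partial derivative `∂_i` of a function on ℝ⁴. -/
def pd (i : Fin 4) (f : (Fin 4 → ℝ) → ℝ) (x : Fin 4 → ℝ) : ℝ :=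
  fderiv ℝ f x (Pi.single i 1)

/-- Christoffel symbols `Γ^k_{ij} = (1/2) Σ_l g^{kl}(∂_i g_{jl} + ∂_j g_{il} − ∂_l g_{ij})`. -/
def Gam (a b p q s : ℝ) (k i j : Fin 4) (x : Fin 4 → ℝ) : ℝ :=
  (1 / 2) * ∑ l, ginv a b p q s x k l *
    (pd i (fun y => gmat a b p q s y j l) x
      + pd j (fun y => gmat a b p q s y i l) x
      - pd l (fun y => gmat a b p q s y i j) x)

/-- Curvature tensor
`R^i_{jkl} = ∂_k Γ^i_{lj} − ∂_l Γ^i_{kj} + Σ_m (Γ^i_{km} Γ^m_{lj} − Γ^i_{lm} Γ^m_{kj})`. -/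
def Riem (a b p q s : ℝ) (i j k l : Fin 4) (x : Fin 4 → ℝ) : ℝ :=
  pd k (Gam a b p q s i l j) x - pd l (Gam a b p q s i k j) x
    + ∑ m, (Gam a b p q s i k m x * Gam a b p q s m l j x
      - Gam a b p q s i l m x * Gam a b p q s m k j x)

/-- Ricci tensor `ρ_{jl} = Σ_i R^i_{jil}`. -/
def Ric (a b p q s : ℝ) (j l : Fin 4) (x : Fin 4 → ℝ) : ℝ :=
  ∑ i, Riem a b p q s i j i l x

/-- Covariant derivative of the curvature tensor
`∇_m R^i_{jkl} = ∂_m R^i_{jkl} + Σ_n (Γ^i_{mn} R^n_{jkl} − Γ^n_{mj} R^i_{nkl}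
  − Γ^n_{mk} R^i_{jnl} − Γ^n_{ml} R^i_{jkn})`. -/
def covR (a b p q s : ℝ) (m i j k l : Fin 4) (x : Fin 4 → ℝ) : ℝ :=
  pd m (Riem a b p q s i j k l) x
    + ∑ n, (Gam a b p q s i m n x * Riem a b p q s n j k l x
      - Gam a b p q s n m j x * Riem a b p q s i n k l x
      - Gam a b p q s n m k x * Riem a b p q s i j n l x
      - Gam a b p q s n m l x * Riem a b p q s i j k n x)

/-- Covariant derivative of a (1,2)-tensor field `T` (components `T^r_{jt}`):
`∇_i T^r_{jt} = ∂_i T^r_{jt} + Σ_n (Γ^r_{in} T^n_{jt} − Γ^n_{ij} T^r_{nt} − Γ^n_{it} T^r_{jn})`. -/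
def covT (a b p q s : ℝ) (T : Fin 4 → Fin 4 → Fin 4 → (Fin 4 → ℝ) → ℝ)
    (i r j t : Fin 4) (x : Fin 4 → ℝ) : ℝ :=
  pd i (T r j t) x
    + ∑ n, (Gam a b p q s r i n x * T n j t x
      - Gam a b p q s n i j x * T r n t x
      - Gam a b p q s n i t x * T r j n x)

theorem pd_const (i : Fin 4) (c : ℝ) (x : Fin 4 → ℝ) : pd i (fun _ => c) x = 0 := by
  simp [pd]

theorem pd_coord (i j : Fin 4) (x : Fin 4 → ℝ) :
    pd i (fun y => y j) x = if i = j then 1 else 0 := by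
  have := (hasFDerivAt_apply (𝕜 := ℝ) j x).fderiv
  rw [pd, this]
  simp [Pi.single_apply, eq_comm]

theorem pd_add (i : Fin 4) (f g : (Fin 4 → ℝ) → ℝ) (x : Fin 4 → ℝ)
    (hf : DifferentiableAt ℝ f x) (hg : DifferentiableAt ℝ g x) :
    pd i (fun y => f y + g y) x = pd i f x + pd i g x := by
  simp [pd, fderiv_fun_add hf hg]

theorem pd_mul (i : Fin 4) (f g : (Fin 4 → ℝ) → ℝ) (x : Fin 4 → ℝ)
    (hf : DifferentiableAt ℝ f x) (hg : DifferentiableAt ℝ g x) :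
    pd i (fun y => f y * g y) x = f x * pd i g x + g x * pd i f x := by
  simp [pd, fderiv_fun_mul hf hg]

/-- The gradient of the profile function `g₄₄`. -/
def gradProfile (a b p q s : ℝ) (i : Fin 4) (x : Fin 4 → ℝ) : ℝ :=
  ![0, 2 * (a * x 3 + p) * x 1 + 2 * q * x 2,
    2 * q * x 1 + 2 * (b * x 3 + s) * x 2, a * (x 1 * x 1) + b * (x 2 * x 2)] i

theorem pd_gmat (a b p q s : ℝ) (i j l : Fin 4) (x : Fin 4 → ℝ) :
    pd i (fun y => gmat a b p q s y j l) x =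
      if j = 3 ∧ l = 3 then gradProfile a b p q s i x else 0 := by
  by_cases h : j = 3 ∧ l = 3
  · obtain ⟨rfl, rfl⟩ := h
    simp only [gmat, Matrix.of_apply, pow_two]
    simp only [Fin.reduceEq, and_false, false_and, and_self, if_true, if_false]
    repeat first
      | rw [pd_add _ _ _ _ (by fun_prop) (by fun_prop)]
      | rw [pd_mul _ _ _ _ (by fun_prop) (by fun_prop)]
    simp only [pd_coord, pd_const]
    fin_cases i <;> simp [gradProfile] <;> ring
  · have : ∀ y, gmat a b p q s y j l = gmat a b p q s 0 j l := fun y => by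
      simp [gmat, h]
    simp only [this, pd_const, h, if_false]

theorem ginv_eq (a b p q s : ℝ) (x : Fin 4 → ℝ) :
    ginv a b p q s x =
      !![-gmat a b p q s x 3 3, 0, 0, 1; 0, 1, 0, 0; 0, 0, 1, 0; 1, 0, 0, 0] := by
  apply Matrix.inv_eq_right_inv
  ext i j
  fin_cases i <;> fin_cases j <;> simp [gmat, Matrix.mul_apply, Fin.sum_univ_four]
  ring

/-- The closed form of the Christoffel symbols. -/
theorem Gam_eq (a b p q s : ℝ) (k i j : Fin 4) :
    Gam a b p q s k i j = fun x =>
      if k = 0 then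
        if i = 3 then (1 / 2) * gradProfile a b p q s j x
        else if j = 3 then (1 / 2) * gradProfile a b p q s i x else 0
      else if k ≠ 3 ∧ i = 3 ∧ j = 3 then (-1 / 2) * gradProfile a b p q s k x else 0 := by
  funext x
  simp only [Gam, pd_gmat, ginv_eq, Fin.sum_univ_four]
  fin_cases k <;> fin_cases i <;> fin_cases j <;>
    simp [gradProfile] <;> ring

/-- Half the Hessian of the profile function in the transversal coordinates. -/
def halfHess (a b p q s : ℝ) (i j : Fin 4) (u : ℝ) : ℝ :=
  if i = 1 ∧ j = 1 then a * u + p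
  else if i = 2 ∧ j = 2 then b * u + s
  else if (i = 1 ∧ j = 2) ∨ (i = 2 ∧ j = 1) then q
  else 0

theorem differentiable_gradProfile (a b p q s : ℝ) (i : Fin 4) :
    Differentiable ℝ (gradProfile a b p q s i) := by
  unfold gradProfile
  fin_cases i <;> simp <;> fun_prop

theorem pd_gradProfile (a b p q s : ℝ) (i j : Fin 4) (x : Fin 4 → ℝ) :
    pd j (gradProfile a b p q s i) x =
      !![0, 0, 0, 0;
        0, 2 * (a * x 3 + p), 2 * q, 2 * a * x 1;
        0, 2 * q, 2 * (b * x 3 + s), 2 * b * x 2;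
        0, 2 * a * x 1, 2 * b * x 2, 0] i j := by
  unfold gradProfile
  fin_cases i <;> simp only [Fin.reduceFinMk, Fin.zero_eta, Fin.mk_one, Matrix.cons_val] <;>
  · repeat first
      | rw [pd_add _ _ _ _ (by fun_prop) (by fun_prop)]
      | rw [pd_mul _ _ _ _ (by fun_prop) (by fun_prop)]
    simp only [pd_coord, pd_const]
    fin_cases j <;> simp <;> ring

theorem pd_const_mul_gradProfile (a b p q s : ℝ) (i j : Fin 4) (c : ℝ) (x : Fin 4 → ℝ) :
    pd i (fun y => c * gradProfile a b p q s j y) x = c * pd i (gradProfile a b p q s j) x := by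
  have h := pd_mul i (fun _ => c) _ x (differentiableAt_const c)
    (differentiable_gradProfile a b p q s j x)
  simpa [pd_const] using h

theorem Riem_zero_left (a b p q s : ℝ) (t j k : Fin 4) (x : Fin 4 → ℝ) :
    Riem a b p q s 0 t j k x =
      (if k = 3 then halfHess a b p q s t j (x 3) else 0)
        - (if j = 3 then halfHess a b p q s t k (x 3) else 0) := by
  have h0 : gradProfile a b p q s 0 x = 0 := by simp [gradProfile]
  simp only [Riem, Gam_eq, Fin.sum_univ_four]
  fin_cases t <;> fin_cases j <;> fin_cases k <;>
    simp [pd_const, pd_const_mul_gradProfile, pd_gradProfile, halfHess, h0]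

theorem Riem_eq_zero (a b p q s : ℝ) {r t : Fin 4} (hr : r ≠ 0) (ht : t ≠ 3)
    (j k : Fin 4) (x : Fin 4 → ℝ) : Riem a b p q s r t j k x = 0 := by
  simp [Riem, Gam_eq, hr, ht, pd_const]

theorem Gam_axis (a b p q s : ℝ) (k i j : Fin 4) (u : ℝ) :
    Gam a b p q s k i j (Pi.single 3 u) = 0 := by
  have h : ∀ l, gradProfile a b p q s l (Pi.single 3 u) = 0 := by
    intro l
    fin_cases l <;> simp [gradProfile]
  simp [Gam_eq, h]

theorem halfHess_eq (a b p q s : ℝ) (i j : Fin 4) (u : ℝ) :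
    halfHess a b p q s i j u = halfHess a b 0 0 0 i j 1 * u + halfHess a b p q s i j 0 := by
  unfold halfHess
  split_ifs <;> ring

theorem covR_axis (a b p q s : ℝ) (m t : Fin 4) {j : Fin 4} (hj : j ≠ 3) (u : ℝ) :
    covR a b p q s m 0 t 3 j (Pi.single 3 u) =
      if m = 3 then -halfHess a b 0 0 0 t j 1 else 0 := by
  have h : Riem a b p q s 0 t 3 j = fun y =>
      -halfHess a b 0 0 0 t j 1 * y 3 + -halfHess a b p q s t j 0 := by
    funext y
    rw [Riem_zero_left, halfHess_eq a b p q s t j]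
    simp only [hj, if_false, if_true]
    ring
  simp only [covR, Gam_axis, zero_mul, sub_zero, add_zero, Finset.sum_const_zero, h]
  rw [pd_add _ _ _ _ (by fun_prop) (by fun_prop), pd_mul _ _ _ _ (by fun_prop) (by fun_prop)]
  simp [pd_coord, pd_const]

/-- The squared norm of the transversal Hessian along the axis `x² = x³ = 0`. -/
def normSqHess (a b p q s u : ℝ) : ℝ := (a * u + p) ^ 2 + 2 * q ^ 2 + (b * u + s) ^ 2

/-- The first two Ambrose–Singer equations determine the scaling of `∂₁` along the axis. -/
theorem scaling_mul_normSqHess (a b p q s u : ℝ) (T : Fin 4 → Fin 4 → Fin 4 → ℝ)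
    (hg : ∀ i j k : Fin 4,
      (∑ m, T m i j * gmat a b p q s (Pi.single 3 u) m k)
        + (∑ m, T m i k * gmat a b p q s (Pi.single 3 u) j m) = 0)
    (hR : ∀ i j k r t : Fin 4,
      covR a b p q s i r t j k (Pi.single 3 u) =
        (∑ m, (T r i m * Riem a b p q s m t j k (Pi.single 3 u)
          - Riem a b p q s r m j k (Pi.single 3 u) * T m i t))
        - (∑ m, T m i j * Riem a b p q s r t m k (Pi.single 3 u))
        - (∑ m, T m i k * Riem a b p q s r t j m (Pi.single 3 u)))
    (m : Fin 4) :
    2 * T 0 m 0 * normSqHess a b p q s u =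
      if m = 3 then a * (a * u + p) + b * (b * u + s) else 0 := by
  have g03 := hg m 0 3
  have g11 := hg m 1 1
  have g22 := hg m 2 2
  have g12 := hg m 1 2
  have e11 := hR m 3 1 0 1
  have e12 := hR m 3 2 0 1
  have e22 := hR m 3 2 0 2
  rw [covR_axis _ _ _ _ _ _ _ (by decide)] at e11 e12 e22
  simp [gmat] at g03 g11 g22 g12
  simp [Fin.sum_univ_four, Riem_zero_left, Riem_eq_zero, halfHess] at e11 e12 e22
  rw [normSqHess]
  rw [eq_neg_of_add_eq_zero_right g03, g11, eq_neg_of_add_eq_zero_left g12] at e11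
  rw [eq_neg_of_add_eq_zero_right g03, g11, g22, eq_neg_of_add_eq_zero_left g12] at e12
  rw [eq_neg_of_add_eq_zero_right g03, g22] at e22
  split_ifs at e11 e22 ⊢ <;>
    linear_combination (a * u + p) * e11 + 2 * q * e12 + (b * u + s) * e22

/-- if `a² + b² ≠ 0`, there is no smooth (1,2)-tensor field `T` on ℝ⁴
satisfying the three Ambrose–Singer equations
(i)  `g(T_{∂_i}∂_j, ∂_k) + g(∂_j, T_{∂_i}∂_k) = 0`;
(ii) `(∇_{∂_i}R)(∂_j,∂_k) = [T_{∂_i}, R(∂_j,∂_k)] − R(T_{∂_i}∂_j, ∂_k) − R(∂_j, T_{∂_i}∂_k)`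
     (in components, with endomorphism indices `r` (up) and `t` (down));
(iii) `(∇_{∂_i}T)_{∂_j} = [T_{∂_i}, T_{∂_j}] − T_{T_{∂_i}∂_j}`.
Consequently no four-dimensional two-symmetric Lorentzian manifold carries a homogeneous
pseudo-Riemannian structure, i.e. none is reductive homogeneous. -/
theorem no_homogeneous_structure (a b p q s : ℝ) (h : a ^ 2 + b ^ 2 ≠ 0) :
    ¬ ∃ T : Fin 4 → Fin 4 → Fin 4 → (Fin 4 → ℝ) → ℝ,
      (∀ k i j : Fin 4, ContDiff ℝ (⊤ : ℕ∞) (T k i j)) ∧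
      (∀ (x : Fin 4 → ℝ) (i j k : Fin 4),
        (∑ m, T m i j x * gmat a b p q s x m k)
          + (∑ m, T m i k x * gmat a b p q s x j m) = 0) ∧
      (∀ (x : Fin 4 → ℝ) (i j k r t : Fin 4),
        covR a b p q s i r t j k x =
          (∑ m, (T r i m x * Riem a b p q s m t j k x
            - Riem a b p q s r m j k x * T m i t x))
          - (∑ m, T m i j x * Riem a b p q s r t m k x)
          - (∑ m, T m i k x * Riem a b p q s r t j m x)) ∧
      (∀ (x : Fin 4 → ℝ) (i j r t : Fin 4),
        covT a b p q s T i r j t x =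
          (∑ m, (T r i m x * T m j t x - T r j m x * T m i t x))
          - (∑ m, T m i j x * T r m t x)) := by
  rintro ⟨T, hT, hg, hR, hcov⟩
  have key := fun u m => scaling_mul_normSqHess a b p q s u
    (fun k i j => T k i j (Pi.single 3 u)) (fun i j k => hg _ i j k)
    (fun i j k r t => hR _ i j k r t) m
  have hder : ∀ u : ℝ, HasDerivAt (fun v : ℝ => T 0 3 0 (Pi.single 3 v))
      (pd 3 (T 0 3 0) (Pi.single 3 u)) u := fun u =>
    (((hT 0 3 0).differentiable (by simp) (Pi.single 3 u)).hasFDerivAt).comp_hasDerivAt u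
      (by simpa using (hasDerivAt_single (𝕜 := ℝ) (3 : Fin 4) u))
  have hode : ∀ u : ℝ, normSqHess a b p q s u ≠ 0 →
      pd 3 (T 0 3 0) (Pi.single 3 u) = T 0 3 0 (Pi.single 3 u) ^ 2 := by
    intro u hu
    have hz : ∀ m : Fin 4, m ≠ 3 → T 0 m 0 (Pi.single 3 u) = 0 := fun m hm => by
      simpa [hm, hu] using key u m
    have h1 := hg (Pi.single 3 u) 3 0 3
    have h3 := hcov (Pi.single 3 u) 3 3 0 0
    simp [gmat] at h1
    simp [covT, Gam_axis, Fin.sum_univ_four, hz 0, hz 1, hz 2] at h3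
    linear_combination h3 - T 0 3 0 (Pi.single 3 u) * h1
  have haff : ∀ c d u : ℝ, HasDerivAt (fun v : ℝ => c * v + d) c u := fun c d u => by
    simpa using ((hasDerivAt_id u).const_mul c).add_const d
  have hN : ∀ u : ℝ, HasDerivAt (normSqHess a b p q s)
      (2 * (a * (a * u + p) + b * (b * u + s))) u := by
    intro u
    refine ((((haff a p u).pow 2).add_const (2 * q ^ 2)).add ((haff b s u).pow 2)).congr_deriv ?_
    simp
    ring
  have hN' : ∀ u : ℝ, HasDerivAt (fun v : ℝ => a * (a * v + p) + b * (b * v + s))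
      (a ^ 2 + b ^ 2) u := by
    intro u
    exact (((haff a p u).const_mul a).add ((haff b s u).const_mul b)).congr_deriv (by ring)
  have hpoly : ∀ u : ℝ, 5 * (a * (a * u + p) + b * (b * u + s)) ^ 2 =
      2 * (a ^ 2 + b ^ 2) * normSqHess a b p q s u := by
    intro u
    by_cases hu : normSqHess a b p q s u = 0
    · have h1 : a * u + p = 0 := by
        rw [normSqHess] at hu
        nlinarith [sq_nonneg (a * u + p), sq_nonneg q, sq_nonneg (b * u + s)]
      have h2 : b * u + s = 0 := by
        rw [normSqHess] at hu
        nlinarith [sq_nonneg (a * u + p), sq_nonneg q, sq_nonneg (b * u + s)]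
      rw [hu, h1, h2]
      ring
    · have h1 : ∀ v, 2 * T 0 3 0 (Pi.single 3 v) * normSqHess a b p q s v =
          a * (a * v + p) + b * (b * v + s) := fun v => by simpa using key v 3
      have h2 := ((((hder u).const_mul 2).mul (hN u)).congr_of_eventuallyEq
        (Filter.Eventually.of_forall fun v => (h1 v).symm)).unique (hN' u)
      rw [hode u hu] at h2
      linear_combination 2 * normSqHess a b p q s u * h2
        - (5 * (a * (a * u + p) + b * (b * u + s))
          + 2 * T 0 3 0 (Pi.single 3 u) * normSqHess a b p q s u) * h1 u
  have h0 := hpoly 0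
  have h1 := hpoly 1
  have h2 := hpoly (-1)
  apply h
  simp only [normSqHess] at h0 h1 h2
  have : (a ^ 2 + b ^ 2) ^ 2 = 0 := by linear_combination (h1 + h2 - 2 * h0) / 6
  exact pow_eq_zero_iff two_ne_zero |>.1 this
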